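/- For every integer n ≥ 4, the full automorphism group of the graph Σ_n = Cay(D_n × Z_3, {(τ_1, 0), (τ_0, 1), (τ_0, 2)}) is isomorphic to the direct product D_n × D_3 of order 12n. -/

import Mathlib

/-- The Cayley graph of a group on a (symmetric) connection set `S`:
distinct `g, h` are adjacent iff `g * h⁻¹ ∈ S`. -/
def cayley {G : Type*} [Group G] (S : Set G) : SimpleGraph G :=
  SimpleGraph.fromRel (fun x y => x * y⁻¹ ∈ S)

/-- In the dihedral group `D_n = ⟨ρ, τ⟩`, the element `τ_i = ρ^i * τ`. -/
def dihTau {n : ℕ} (i : ℕ) : DihedralGroup n :=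
  (DihedralGroup.r 1) ^ i * DihedralGroup.sr 0

/-- The graph `Σ_n = Cay(D_n × Z_3, {(τ_1, 0), (τ_0, 1), (τ_0, 2)})`,
where `Z_3` is the cyclic group of order 3 (written multiplicatively). -/
def sigmaGraph (n : ℕ) : SimpleGraph (DihedralGroup n × Multiplicative (ZMod 3)) :=
  cayley ({(dihTau 1, 1), (dihTau 0, Multiplicative.ofAdd 1), (dihTau 0, Multiplicative.ofAdd 2)} :
    Set (DihedralGroup n × Multiplicative (ZMod 3)))

open DihedralGroup in
/-- The connection set of `sigmaGraph n`, indexed by its `ZMod 3`-coordinate. -/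
def sigmaGen (n : ℕ) (i : ZMod 3) : DihedralGroup n × Multiplicative (ZMod 3) :=
  (sr (if i = 0 then -1 else 0), Multiplicative.ofAdd i)

theorem sigmaGen_inv (n : ℕ) (i : ZMod 3) : (sigmaGen n i)⁻¹ = sigmaGen n (-i) := by
  simp [sigmaGen]

theorem sigmaGen_ne_one (n : ℕ) (i : ZMod 3) : sigmaGen n i ≠ 1 := by
  intro h
  cases congrArg Prod.fst h

theorem sigmaGen_injective (n : ℕ) : Function.Injective (sigmaGen n) := fun _ _ h =>
  Multiplicative.ofAdd.injective (congrArg Prod.snd h)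

theorem sigmaGraph_adj {n : ℕ} {x y : DihedralGroup n × Multiplicative (ZMod 3)} :
    (sigmaGraph n).Adj x y ↔ ∃ i, y = sigmaGen n i * x := by
  have mem : ∀ z : DihedralGroup n × Multiplicative (ZMod 3),
      z ∈ ({(dihTau 1, 1), (dihTau 0, Multiplicative.ofAdd 1),
        (dihTau 0, Multiplicative.ofAdd 2)} : Set _) ↔ ∃ i, z = sigmaGen n i := by
    intro z
    have h3 : ∀ p : ZMod 3 → Prop, (∃ i, p i) ↔ p 0 ∨ p 1 ∨ p 2 := fun p =>
      Fin.exists_fin_succ.trans (or_congr Iff.rfl Fin.exists_fin_two)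
    have h2 : (2 : ZMod 3) ≠ 0 := by decide
    rw [h3]
    simp [sigmaGen, dihTau, h2]
  simp only [sigmaGraph, cayley, SimpleGraph.fromRel_adj, mem, mul_inv_eq_iff_eq_mul]
  constructor
  · rintro ⟨-, ⟨i, rfl⟩ | ⟨i, rfl⟩⟩
    · exact ⟨-i, by rw [← sigmaGen_inv, inv_mul_cancel_left]⟩
    · exact ⟨i, rfl⟩
  · rintro ⟨i, rfl⟩
    exact ⟨fun h => sigmaGen_ne_one n i (by simpa using h.symm), .inr ⟨i, rfl⟩⟩

/-- A closed non-backtracking walk of length six. -/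
def SimpleGraph.IsHexagon {V : Type*} (G : SimpleGraph V) (a b c d e f : V) : Prop :=
  (G.Adj a b ∧ G.Adj b c ∧ G.Adj c d ∧ G.Adj d e ∧ G.Adj e f ∧ G.Adj f a) ∧
    a ≠ c ∧ b ≠ d ∧ c ≠ e ∧ d ≠ f ∧ e ≠ a

theorem SimpleGraph.IsHexagon.map {V : Type*} {G : SimpleGraph V} {a b c d e f : V}
    (h : G.IsHexagon a b c d e f) (φ : G ≃g G) :
    G.IsHexagon (φ a) (φ b) (φ c) (φ d) (φ e) (φ f) := by
  simpa only [SimpleGraph.IsHexagon, φ.map_adj_iff, φ.injective.ne_iff] using h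

/-- The edge from `a` to `b` starts a path of length two that extends to hexagons in two ways. -/
def SimpleGraph.IsBranchingEdge {V : Type*} (G : SimpleGraph V) (a b : V) : Prop :=
  ∃ c d e f d' e' f', G.IsHexagon a b c d e f ∧ G.IsHexagon a b c d' e' f' ∧ d ≠ d'

theorem SimpleGraph.IsBranchingEdge.map {V : Type*} {G : SimpleGraph V} {a b : V}
    (h : G.IsBranchingEdge a b) (φ : G ≃g G) : G.IsBranchingEdge (φ a) (φ b) := by
  obtain ⟨c, d, e, f, d', e', f', h, h', hd⟩ := h
  exact ⟨_, _, _, _, _, _, _, h.map φ, h'.map φ, φ.injective.ne hd⟩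

theorem ZMod.intCast_eq_zero_of_abs_lt {n : ℕ} {k : ℤ} (h : (k : ZMod n) = 0) (hk : |k| < n) :
    k = 0 :=
  Int.eq_zero_of_abs_lt_dvd ((ZMod.intCast_zmod_eq_zero_iff_dvd k n).1 h) hk

theorem sigmaGen_prod_six {n : ℕ} (hn : 4 ≤ n) {a b c d e f : ZMod 3}
    (h : sigmaGen n a * (sigmaGen n b * (sigmaGen n c *
      (sigmaGen n d * (sigmaGen n e * sigmaGen n f)))) = 1) :
    a + b + c + d + e + f = 0 ∧
      ((if a = 0 then 1 else 0) + (if c = 0 then 1 else 0) + (if e = 0 then 1 else 0) : ℕ) =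
        (if b = 0 then 1 else 0) + (if d = 0 then 1 else 0) + (if f = 0 then 1 else 0) := by
  obtain ⟨h1, h2⟩ := Prod.ext_iff.1 h
  refine ⟨?_, ?_⟩
  · have := congrArg Multiplicative.toAdd h2
    simpa [sigmaGen, add_assoc] using this
  · simp only [sigmaGen, Prod.fst_mul, DihedralGroup.sr_mul_sr, DihedralGroup.sr_mul_r,
      Prod.fst_one, DihedralGroup.one_def, DihedralGroup.r.injEq] at h1
    let ε : ZMod 3 → ℤ := fun i => if i = 0 then 1 else 0
    have hε : ∀ i, 0 ≤ ε i ∧ ε i ≤ 1 := fun i => by dsimp only [ε]; split <;> simp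
    have cast : ((ε a + ε c + ε e - (ε b + ε d + ε f) : ℤ) : ZMod n) = 0 := by
      rw [← h1]
      have (i : ZMod 3) : (if i = 0 then -1 else 0 : ZMod n) = -((ε i : ℤ) : ZMod n) := by
        dsimp only [ε]; split <;> simp
      simp only [this]
      push_cast
      ring
    have key := ZMod.intCast_eq_zero_of_abs_lt cast (by
      have := hε a; have := hε b; have := hε c; have := hε d; have := hε e; have := hε f
      rw [abs_lt]; omega)
    zify
    exact sub_eq_zero.1 key

theorem hexagon_word_unique : ∀ b c : ZMod 3, b ≠ -0 → c ≠ -b → ∀ d, d ≠ -c → ∀ e, e ≠ -d →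
    ∀ f, f ≠ -e →
    (f + e + d + c + b + 0 = 0 ∧
      ((if f = 0 then 1 else 0) + (if d = 0 then 1 else 0) + (if b = 0 then 1 else 0) : ℕ) =
        (if e = 0 then 1 else 0) + (if c = 0 then 1 else 0) + (if (0 : ZMod 3) = 0 then 1 else 0)) →
    c = b := by
  decide

theorem sigmaGen_mul_sigmaGen_eq_one {n : ℕ} {i j : ZMod 3} :
    sigmaGen n j * sigmaGen n i = 1 ↔ j = -i := by
  rw [mul_eq_one_iff_eq_inv, sigmaGen_inv, (sigmaGen_injective n).eq_iff]

theorem ne_sigmaGen_mul_sigmaGen_mul {n : ℕ} {i j : ZMod 3}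
    {x : DihedralGroup n × Multiplicative (ZMod 3)} :
    x ≠ sigmaGen n j * (sigmaGen n i * x) ↔ j ≠ -i := by
  rw [← mul_assoc, ne_comm, Ne, mul_eq_right, sigmaGen_mul_sigmaGen_eq_one]

theorem isHexagon_sigmaGraph_unique {n : ℕ} (hn : 4 ≤ n)
    {u w x y : DihedralGroup n × Multiplicative (ZMod 3)} {i : ZMod 3}
    (h : (sigmaGraph n).IsHexagon u (sigmaGen n 0 * u) (sigmaGen n i * (sigmaGen n 0 * u)) w x y) :
    w = sigmaGen n i * (sigmaGen n i * (sigmaGen n 0 * u)) := by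
  obtain ⟨⟨-, -, h3, h4, h5, h6⟩, n1, n2, n3, n4, n5⟩ := h
  obtain ⟨c, rfl⟩ := sigmaGraph_adj.1 h3
  obtain ⟨d, rfl⟩ := sigmaGraph_adj.1 h4
  obtain ⟨e, rfl⟩ := sigmaGraph_adj.1 h5
  obtain ⟨f, h6⟩ := sigmaGraph_adj.1 h6
  rw [ne_sigmaGen_mul_sigmaGen_mul] at n1 n2 n3 n4
  have n5 := ne_sigmaGen_mul_sigmaGen_mul.1 (n5.trans_eq h6)
  have := hexagon_word_unique i c n1 n2 d n3 e n4 f n5 (sigmaGen_prod_six hn (by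
    simpa [← mul_assoc] using h6.symm))
  rw [this]

theorem isHexagon_sigmaGraph {n : ℕ} {a b c d e f : ZMod 3}
    (h : sigmaGen n f * (sigmaGen n e * (sigmaGen n d *
      (sigmaGen n c * (sigmaGen n b * sigmaGen n a)))) = 1)
    (hb : b ≠ -a) (hc : c ≠ -b) (hd : d ≠ -c) (he : e ≠ -d) (hf : f ≠ -e)
    (u : DihedralGroup n × Multiplicative (ZMod 3)) :
    (sigmaGraph n).IsHexagon u (sigmaGen n a * u) (sigmaGen n b * (sigmaGen n a * u))
      (sigmaGen n c * (sigmaGen n b * (sigmaGen n a * u)))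
      (sigmaGen n d * (sigmaGen n c * (sigmaGen n b * (sigmaGen n a * u))))
      (sigmaGen n e * (sigmaGen n d * (sigmaGen n c * (sigmaGen n b * (sigmaGen n a * u))))) := by
  have h : u = sigmaGen n f * (sigmaGen n e * (sigmaGen n d *
      (sigmaGen n c * (sigmaGen n b * (sigmaGen n a * u))))) := by
    simpa only [mul_assoc, one_mul] using congrArg (· * u) h.symm
  refine ⟨⟨?_, ?_, ?_, ?_, ?_, sigmaGraph_adj.2 ⟨f, h⟩⟩, ?_, ?_, ?_, ?_, fun h' => ?_⟩
  iterate 5 exact sigmaGraph_adj.2 ⟨_, rfl⟩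
  iterate 4 exact ne_sigmaGen_mul_sigmaGen_mul.2 ‹_›
  exact ne_sigmaGen_mul_sigmaGen_mul.2 hf (h'.trans h)

theorem isBranchingEdge_sigmaGraph {n : ℕ} (hn : 4 ≤ n)
    {u v : DihedralGroup n × Multiplicative (ZMod 3)} :
    (sigmaGraph n).IsBranchingEdge u v ↔ ∃ i ≠ 0, v = sigmaGen n i * u := by
  constructor
  · rintro ⟨w, x, y, z, x', y', z', h, h', hne⟩
    obtain ⟨i, rfl⟩ := sigmaGraph_adj.1 h.1.1
    refine ⟨i, ?_, rfl⟩
    rintro rfl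
    obtain ⟨j, rfl⟩ := sigmaGraph_adj.1 h.1.2.1
    exact hne ((isHexagon_sigmaGraph_unique hn h).trans (isHexagon_sigmaGraph_unique hn h').symm)
  · rintro ⟨i, hi, rfl⟩
    have ne_neg : ∀ j : ZMod 3, j ≠ 0 → j ≠ -j ∧
        j + (j + (j + (j + (j + j)))) = 0 := by decide
    obtain ⟨h, h'⟩ := ne_neg i hi
    refine ⟨_, _, _, _, _, _, _,
      isHexagon_sigmaGraph (a := i) (b := i) (c := i) (d := i) (e := i) (f := i) ?_ h h h h h u,
      isHexagon_sigmaGraph (a := i) (b := i) (c := 0) (d := -i) (e := -i) (f := 0) ?_ h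
        (by simpa using hi) (by simpa using hi) (by simpa using h.symm)
        (by simpa using hi.symm) u, ?_⟩
    · simp [sigmaGen, hi, ← ofAdd_add, h', Prod.ext_iff]
    · simp [sigmaGen, hi, Prod.ext_iff]
    · simpa [(sigmaGen_injective n).eq_iff] using hi

open DihedralGroup in
theorem sigmaGen_mul_self_mul_self (n : ℕ) {i : ZMod 3} (hi : i ≠ 0) :
    sigmaGen n i * (sigmaGen n i * sigmaGen n i) = (sr 0, 1) := by
  have : ∀ i : ZMod 3, i + (i + i) = 0 := by decide
  simp [sigmaGen, hi, ← ofAdd_add, this]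

theorem map_sigmaGen_mul {n : ℕ} (hn : 4 ≤ n) (f : sigmaGraph n ≃g sigmaGraph n) {i : ZMod 3}
    (hi : i ≠ 0) (u : DihedralGroup n × Multiplicative (ZMod 3)) :
    ∃ j ≠ 0, f (sigmaGen n i * u) = sigmaGen n j * f u :=
  (isBranchingEdge_sigmaGraph hn).1 (((isBranchingEdge_sigmaGraph hn).2 ⟨i, hi, rfl⟩).map f)

theorem map_sigmaGen_zero_mul {n : ℕ} (hn : 4 ≤ n) (f : sigmaGraph n ≃g sigmaGraph n)
    (u : DihedralGroup n × Multiplicative (ZMod 3)) :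
    f (sigmaGen n 0 * u) = sigmaGen n 0 * f u := by
  obtain ⟨j, hj⟩ := sigmaGraph_adj.1 (f.map_adj_iff.2 (sigmaGraph_adj.2 ⟨0, rfl⟩))
  obtain rfl | hj0 := eq_or_ne j 0
  · exact hj
  · obtain ⟨k, hk, h⟩ := map_sigmaGen_mul hn f.symm hj0 (f u)
    rw [← hj, f.symm_apply_apply, f.symm_apply_apply, mul_left_inj,
      (sigmaGen_injective n).eq_iff] at h
    exact absurd h.symm hk

open DihedralGroup in
theorem map_antipode {n : ℕ} (hn : 4 ≤ n) (f : sigmaGraph n ≃g sigmaGraph n)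
    (u : DihedralGroup n × Multiplicative (ZMod 3)) :
    f ((sr 0, 1) * u) = (sr 0, 1) * f u := by
  have one_ne : (1 : ZMod 3) ≠ 0 := by decide
  have straight : ∀ x i, i ≠ 0 → f (sigmaGen n 1 * x) = sigmaGen n i * f x →
      f (sigmaGen n 1 * (sigmaGen n 1 * x)) = sigmaGen n i * f (sigmaGen n 1 * x) := by
    intro x i hi h
    obtain ⟨j, hj, h'⟩ := map_sigmaGen_mul hn f one_ne (sigmaGen n 1 * x)
    have hji : j ≠ -i := by
      rw [← ne_sigmaGen_mul_sigmaGen_mul (x := f x), ← h, ← h', f.injective.ne_iff,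
        ne_sigmaGen_mul_sigmaGen_mul]
      decide
    have : ∀ i j : ZMod 3, i ≠ 0 → j ≠ 0 → j ≠ -i → j = i := by decide
    rwa [this i j hi hj hji] at h'
  obtain ⟨i, hi, h1⟩ := map_sigmaGen_mul hn f one_ne u
  have h2 := straight _ _ hi h1
  have h3 := straight _ _ hi h2
  rw [h2, h1] at h3
  calc
    _ = f (sigmaGen n 1 * (sigmaGen n 1 * (sigmaGen n 1 * u))) := by
      rw [← sigmaGen_mul_self_mul_self n one_ne, mul_assoc, mul_assoc]
    _ = _ := by rw [h3, ← sigmaGen_mul_self_mul_self n hi, mul_assoc, mul_assoc]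

open DihedralGroup in
theorem map_dihedral_mul {n : ℕ} (hn : 4 ≤ n) (f : sigmaGraph n ≃g sigmaGraph n)
    (d : DihedralGroup n) (u : DihedralGroup n × Multiplicative (ZMod 3)) :
    f ((d, 1) * u) = (d, 1) * f u := by
  have : NeZero n := ⟨by omega⟩
  have rot_one : ∀ u, f ((r 1, 1) * u) = (r 1, 1) * f u := fun u => by
    have : ((r 1, 1) : DihedralGroup n × Multiplicative (ZMod 3)) =
        sigmaGen n 0 * (sr 0, 1) := by simp [sigmaGen]
    rw [this, mul_assoc, map_sigmaGen_zero_mul hn, map_antipode hn, mul_assoc]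
  have rot : ∀ (k : ℕ) u, f ((r k, 1) * u) = (r k, 1) * f u := fun k => by
    induction k with
    | zero => intro u; simp [← Prod.one_eq_mk]
    | succ k ih =>
      intro u
      have : ((r (k + 1 : ℕ), 1) : DihedralGroup n × Multiplicative (ZMod 3)) =
        (r k, 1) * (r 1, 1) := by simp
      rw [this, mul_assoc, ih, rot_one, mul_assoc]
  obtain i | i := d
  · simpa using rot i.val u
  · have : ((sr i, 1) : DihedralGroup n × Multiplicative (ZMod 3)) =
        (sr 0, 1) * (r (i.val : ℕ), 1) := by simp
    rw [this, mul_assoc, map_antipode hn, rot, mul_assoc]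

open DihedralGroup in
theorem sigmaGraph_adj_iff {n : ℕ} {x y : DihedralGroup n × Multiplicative (ZMod 3)} :
    (sigmaGraph n).Adj x y ↔
      y.1 = sr (-1) * x.1 ∧ y.2 = x.2 ∨ y.1 = sr 0 * x.1 ∧ y.2 ≠ x.2 := by
  rw [sigmaGraph_adj]
  constructor
  · rintro ⟨i, rfl⟩
    by_cases hi : i = 0 <;> simp [sigmaGen, hi]
  · rintro (⟨h1, h2⟩ | ⟨h1, h2⟩)
    · exact ⟨0, Prod.ext (by simpa [sigmaGen] using h1) (by simpa [sigmaGen] using h2)⟩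
    · have hi : (y.2 / x.2).toAdd ≠ 0 := by simpa [sub_eq_zero] using h2
      exact ⟨(y.2 / x.2).toAdd, Prod.ext (by simpa only [sigmaGen, if_neg hi, Prod.fst_mul] using h1)
        (div_mul_cancel y.2 x.2).symm⟩

theorem map_one_fst {n : ℕ} (hn : 4 ≤ n) (f : sigmaGraph n ≃g sigmaGraph n)
    (a b : Multiplicative (ZMod 3)) : (f (1, a)).1 = (f (1, b)).1 := by
  obtain rfl | hab := eq_or_ne a b
  · rfl
  have hi : (b / a).toAdd ≠ 0 := by simpa [sub_eq_zero] using hab.symm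
  obtain ⟨j, hj, h⟩ := map_sigmaGen_mul hn f hi (1, a)
  have : sigmaGen n (b / a).toAdd * (1, a) = (DihedralGroup.sr 0, 1) * (1, b) := by
    simp only [sigmaGen, if_neg hi]
    simp
  rw [this, map_antipode hn] at h
  have := congrArg Prod.fst h
  simpa [sigmaGen, hj] using this.symm

theorem map_eq_mk {n : ℕ} (hn : 4 ≤ n) (f : sigmaGraph n ≃g sigmaGraph n)
    (x : DihedralGroup n × Multiplicative (ZMod 3)) :
    f x = (x.1 * (f 1).1, (f (1, x.2)).2) := by
  have : f x = (x.1, 1) * f (1, x.2) := by simpa using map_dihedral_mul hn f x.1 (1, x.2)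
  rw [this]
  ext
  · exact congrArg (x.1 * ·) (map_one_fst hn f _ _)
  · exact one_mul (f (1, x.2)).2

/-- `D_n` acts on `sigmaGraph n` by right multiplication, and every permutation of `ZMod 3` acts
on the second coordinate. -/
def sigmaAut (n : ℕ) :
    DihedralGroup n × Equiv.Perm (Multiplicative (ZMod 3)) →* (sigmaGraph n ≃g sigmaGraph n) where
  toFun p :=
    { toEquiv := (Equiv.mulRight p.1⁻¹).prodCongr p.2
      map_rel_iff' := by simp [sigmaGraph_adj_iff, ← mul_assoc] }
  map_one' := by ext x <;> simp
  map_mul' p q := by ext x <;> simp [mul_assoc]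

@[simp]
theorem sigmaAut_apply {n : ℕ} (p : DihedralGroup n × Equiv.Perm (Multiplicative (ZMod 3)))
    (x : DihedralGroup n × Multiplicative (ZMod 3)) :
    sigmaAut n p x = (x.1 * p.1⁻¹, p.2 x.2) :=
  rfl

theorem sigmaAut_bijective {n : ℕ} (hn : 4 ≤ n) : Function.Bijective (sigmaAut n) := by
  constructor
  · intro p q h
    have key : ∀ x, sigmaAut n p x = sigmaAut n q x := fun x => by rw [h]
    ext1
    · simpa using congrArg Prod.fst (key 1)
    · ext1 a
      simpa using congrArg Prod.snd (key (1, a))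
  · intro f
    let σ : Multiplicative (ZMod 3) → Multiplicative (ZMod 3) := fun a => (f (1, a)).2
    have hσ : Function.Injective σ := fun a b h => by
      have := f.injective (Prod.ext (map_one_fst hn f a b) h)
      exact congrArg Prod.snd this
    refine ⟨((f 1).1⁻¹, Equiv.ofBijective σ (Finite.injective_iff_bijective.1 hσ)), ?_⟩
    ext1 x
    rw [map_eq_mk hn f x]
    simp [σ]

/-- The action of `D_3` on the vertices of a triangle. -/
def dihedralThreeToPerm : DihedralGroup 3 →* Equiv.Perm (Multiplicative (ZMod 3)) where
  toFun
    | .r i => Equiv.mulLeft (Multiplicative.ofAdd i)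
    | .sr i => Equiv.divLeft (Multiplicative.ofAdd (-i))
  map_one' := by decide
  map_mul' := by decide

theorem dihedralThreeToPerm_bijective : Function.Bijective dihedralThreeToPerm := by
  refine (Fintype.bijective_iff_injective_and_card _).2 ⟨by decide, ?_⟩
  rw [DihedralGroup.card, Fintype.card_perm, Fintype.card_multiplicative, ZMod.card]
  rfl

/-- For `n ≥ 4`, the full automorphism group of `Σ_n` is isomorphic to the
direct product `D_n × D_3` of order `12n`. -/
theorem sigma_aut_eq_dihedral_prod (n : ℕ) (hn : 4 ≤ n) :
    Nonempty ((sigmaGraph n ≃g sigmaGraph n) ≃* (DihedralGroup n × DihedralGroup 3)) := by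
  exact ⟨((MulEquiv.prodCongr (.refl _) (.ofBijective _ dihedralThreeToPerm_bijective)).trans
    (.ofBijective _ (sigmaAut_bijective hn))).symm⟩
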